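/- Quadratic contraction identity (pointwise form of Lemma contract1): let φ be a 3-form on ℝ⁶ with ω ∧ φ = 0, λ_φ < 0, and ω(x, J_φ x) > 0 for all x ≠ 0. Write φ_{ijk} := φ(e_i,e_j,e_k), ω_{ij} := ω(e_i,e_j), let (ω^{ij}) be the inverse matrix of (ω_{ij}), and define g̃_{ij} := −Σ_{a,b,c,d} ω^{ac} ω^{bd} φ_{iab} φ_{jcd}. Then for all a, b, c, d ∈ {1,…,6}: Σ_{i,j} ω^{ij} φ_{iab} φ_{jcd} = (1/4)( ω_{ac} g̃_{bd} − ω_{bc} g̃_{ad} − ω_{ad} g̃_{bc} + ω_{bd} g̃_{ac} ). -/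

import Mathlib

noncomputable section

/-- The underlying vector space `V = ℝ⁶`. -/
abbrev V6 : Type := Fin 6 → ℝ

/-- The standard basis of `ℝ⁶`. -/
def e6 (i : Fin 6) : V6 := fun j => if j = i then (1 : ℝ) else 0

/-- The standard symplectic form `ω = e¹∧e² + e³∧e⁴ + e⁵∧e⁶`. -/
def ω6 (x y : V6) : ℝ :=
  x 0 * y 1 - x 1 * y 0 + x 2 * y 3 - x 3 * y 2 + x 4 * y 5 - x 5 * y 4

/-- Wedge product of a 2-form and a 3-form (standard convention `1/(2!·3!)`). -/
def wedge23 (a : V6 → V6 → ℝ) (b : V6 → V6 → V6 → ℝ) (v : Fin 5 → V6) : ℝ :=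
  (1 / 12 : ℝ) * ∑ σ : Equiv.Perm (Fin 5),
    ((Equiv.Perm.sign σ : ℤ) : ℝ) *
      (a (v (σ 0)) (v (σ 1)) * b (v (σ 2)) (v (σ 3)) (v (σ 4)))

/-- Hitchin's map `K_φ`, characterized by `ι_{K_φ v} vol = -(ι_v φ) ∧ φ` (here written out
in components using the volume form `vol = e¹∧⋯∧e⁶`). -/
def Kmap (φ : V6 → V6 → V6 → ℝ) (x : V6) : V6 := fun i =>
  (-1 : ℝ) ^ (i : ℕ) *
    (-(wedge23 (fun y z => φ x y z) φ (fun j => e6 (i.succAbove j))))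

/-- Hitchin's invariant `λ_φ = (1/6)·tr(K_φ²)`. -/
def lamH (φ : V6 → V6 → V6 → ℝ) : ℝ :=
  (1 / 6 : ℝ) * ∑ i : Fin 6, Kmap φ (Kmap φ (e6 i)) i

/-- Hitchin's almost complex structure `J_φ = K_φ / √(-λ_φ)`. -/
def Jmap (φ : V6 → V6 → V6 → ℝ) (x : V6) : V6 :=
  (Real.sqrt (-(lamH φ)))⁻¹ • Kmap φ x

/-- A 3-form, viewed as a trilinear function of vectors. -/
def ap3 (φ : AlternatingMap ℝ V6 ℝ (Fin 3)) : V6 → V6 → V6 → ℝ :=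
  fun x y z => φ ![x, y, z]


/-- The matrix `(ω_{ij}) = (ω(e_i, e_j))` of the standard symplectic form. -/
def Ωmat : Matrix (Fin 6) (Fin 6) ℝ := Matrix.of fun i j => ω6 (e6 i) (e6 j)

/-- The metric `g̃_{ij} := −Σ ω^{ac} ω^{bd} φ_{iab} φ_{jcd}`. -/
def gTilde (φ : AlternatingMap ℝ V6 ℝ (Fin 3)) (i j : Fin 6) : ℝ :=
  -(∑ a : Fin 6, ∑ b : Fin 6, ∑ c : Fin 6, ∑ d : Fin 6,
      Ωmat⁻¹ a c * Ωmat⁻¹ b d * (φ ![e6 i, e6 a, e6 b] * φ ![e6 j, e6 c, e6 d]))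

theorem Equiv.Perm.sum_fin_succ {M : Type*} [AddCommMonoid M] {n : ℕ}
    (F : Equiv.Perm (Fin (n + 1)) → M) :
    ∑ σ, F σ = ∑ p, ∑ e, F (Equiv.Perm.decomposeFin.symm (p, e)) := by
  rw [← Equiv.Perm.decomposeFin.symm.sum_comp, Fintype.sum_prod_type]

open Equiv.Perm in
set_option maxHeartbeats 2000000 in
/-- The wedge product of an antisymmetric 2-array and an antisymmetric 3-array on five indices,
as a sum over `(2,3)`-shuffles. -/
theorem sum_perm_five_eq_shuffles {A : Fin 5 → Fin 5 → ℝ} {F : Fin 5 → Fin 5 → Fin 5 → ℝ}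
    (hA : ∀ i j, A i j = -A j i) (h12 : ∀ i j k, F i j k = -F j i k)
    (h23 : ∀ i j k, F i j k = -F i k j) :
    ∑ σ : Equiv.Perm (Fin 5), ((Equiv.Perm.sign σ : ℤ) : ℝ) *
      (A (σ 0) (σ 1) * F (σ 2) (σ 3) (σ 4)) =
    12 * (A 0 1 * F 2 3 4 - A 0 2 * F 1 3 4 + A 0 3 * F 1 2 4 - A 0 4 * F 1 2 3
      + A 1 2 * F 0 3 4 - A 1 3 * F 0 2 4 + A 1 4 * F 0 2 3
      + A 2 3 * F 0 1 4 - A 2 4 * F 0 1 3 + A 3 4 * F 0 1 2) := by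
  have sA : ∀ i j, j < i → A i j = -A j i := fun i j _ => hA i j
  have s12 : ∀ i j k, j < i → F i j k = -F j i k := fun i j k _ => h12 i j k
  have s23 : ∀ i j k, k < j → F i j k = -F i k j := fun i j k _ => h23 i j k
  have e2 : (2 : Fin 5) = Fin.succ 1 := rfl
  have e3 : (3 : Fin 5) = Fin.succ 2 := rfl
  have e4 : (4 : Fin 5) = Fin.succ 3 := rfl
  have f2 : (2 : Fin 4) = Fin.succ 1 := rfl
  have f3 : (3 : Fin 4) = Fin.succ 2 := rfl
  have g2 : (2 : Fin 3) = Fin.succ 1 := rfl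
  conv_lhs =>
    rw [sum_fin_succ]
    simp only [e2, e3, e4, decomposeFin.symm_sign, decomposeFin_symm_apply_zero,
      decomposeFin_symm_apply_one, decomposeFin_symm_apply_succ]
    simp only [sum_fin_succ (n := 3), f2, f3, decomposeFin.symm_sign,
      decomposeFin_symm_apply_zero, decomposeFin_symm_apply_one, decomposeFin_symm_apply_succ]
    simp only [sum_fin_succ (n := 2), g2, decomposeFin.symm_sign,
      decomposeFin_symm_apply_zero, decomposeFin_symm_apply_one, decomposeFin_symm_apply_succ]
    simp only [sum_fin_succ (n := 1), decomposeFin.symm_sign,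
      decomposeFin_symm_apply_zero, decomposeFin_symm_apply_one]
    simp only [Finset.univ_unique, Finset.sum_singleton, Fin.sum_univ_succ]
  simp [Equiv.swap_apply_def]
  simp [sA, s12, s23]
  ring

/-- The index conjugate to `i` in the standard symplectic basis. -/
def conjIdx : Fin 6 → Fin 6 := ![1, 0, 3, 2, 5, 4]

/-- The sign of the nonzero entry in row `i` of the inverse symplectic matrix. -/
def conjSign : Fin 6 → ℝ := ![-1, 1, -1, 1, -1, 1]

theorem Ωmat_apply (i j : Fin 6) : Ωmat i j = if j = conjIdx i then -conjSign i else 0 := by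
  fin_cases i <;> fin_cases j <;> simp [Ωmat, ω6, e6, conjIdx, conjSign]

theorem Ωmat_inv_apply (i j : Fin 6) :
    Ωmat⁻¹ i j = if j = conjIdx i then conjSign i else 0 := by
  have h : Ωmat⁻¹ = -Ωmat := by
    apply Matrix.inv_eq_right_inv
    ext i j
    fin_cases i <;> fin_cases j <;>
      simp [Matrix.mul_apply, Fin.sum_univ_six, Ωmat_apply, conjIdx, conjSign]
  rw [h, Matrix.neg_apply, Ωmat_apply]
  split_ifs <;> simp

section TotallyAntisymmetric

variable {F : Fin 6 → Fin 6 → Fin 6 → ℝ}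

/-- The contraction of `ω` with two indices of an array vanishes. -/
def TraceFree (F : Fin 6 → Fin 6 → Fin 6 → ℝ) : Prop :=
  ∀ i, F i 0 1 + F i 2 3 + F i 4 5 = 0

theorem traceFree_of_wedge (h12 : ∀ i j k, F i j k = -F j i k)
    (h23 : ∀ i j k, F i j k = -F i k j)
    (hw : ∀ w : Fin 5 → Fin 6, ∑ σ : Equiv.Perm (Fin 5), ((Equiv.Perm.sign σ : ℤ) : ℝ) *
      (Ωmat (w (σ 0)) (w (σ 1)) * F (w (σ 2)) (w (σ 3)) (w (σ 4))) = 0) : TraceFree F := by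
  have z12 : ∀ i k, F i i k = 0 := fun i k => by linarith [h12 i i k]
  have z23 : ∀ i k, F i k k = 0 := fun i k => by linarith [h23 i k k]
  have z13 : ∀ i k, F i k i = 0 := fun i k => by rw [h23, z12, neg_zero]
  have hΩ : ∀ i j, Ωmat i j = -Ωmat j i := fun i j => by simp only [Ωmat, Matrix.of_apply, ω6]; ring
  have h := fun w : Fin 5 → Fin 6 =>
    (sum_perm_five_eq_shuffles (A := fun i j => Ωmat (w i) (w j))
      (F := fun i j k => F (w i) (w j) (w k)) (fun _ _ => hΩ _ _) (fun _ _ _ => h12 _ _ _)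
      (fun _ _ _ => h23 _ _ _)).symm.trans (hw w)
  intro i
  fin_cases i
  · have := h ![0, 2, 3, 4, 5]
    simp [Ωmat_apply, conjIdx, conjSign] at this
    simp [z12]
    linarith
  · have := h ![1, 2, 3, 4, 5]
    simp [Ωmat_apply, conjIdx, conjSign] at this
    simp [z13]
    linarith
  · have := h ![2, 0, 1, 4, 5]
    simp [Ωmat_apply, conjIdx, conjSign] at this
    simp [z12]
    linarith
  · have := h ![3, 0, 1, 4, 5]
    simp [Ωmat_apply, conjIdx, conjSign] at this
    simp [z13]
    linarith
  · have := h ![4, 0, 1, 2, 3]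
    simp [Ωmat_apply, conjIdx, conjSign] at this
    simp [z12]
    linarith
  · have := h ![5, 0, 1, 2, 3]
    simp [Ωmat_apply, conjIdx, conjSign] at this
    simp [z13]
    linarith

set_option maxHeartbeats 4000000 in
theorem quadratic_contraction_of_traceFree (h12 : ∀ i j k, F i j k = -F j i k)
    (h23 : ∀ i j k, F i j k = -F i k j) (htr : TraceFree F)
    {G : Fin 6 → Fin 6 → ℝ}
    (hG : ∀ i j, G i j = -∑ a, ∑ b,
      conjSign a * conjSign b * (F i a b * F j (conjIdx a) (conjIdx b)))
    (a b c d : Fin 6) :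
    ∑ i, conjSign i * F i a b * F (conjIdx i) c d = (1 / 4 : ℝ) *
      (Ωmat a c * G b d - Ωmat b c * G a d - Ωmat a d * G b c + Ωmat b d * G a c) := by
  have s12 : ∀ i j k, j < i → F i j k = -F j i k := fun i j k _ => h12 i j k
  have s23 : ∀ i j k, k < j → F i j k = -F i k j := fun i j k _ => h23 i j k
  have z12 : ∀ i k, F i i k = 0 := fun i k => by linarith [h12 i i k]
  have z23 : ∀ i k, F i k k = 0 := fun i k => by linarith [h23 i k k]
  have t0 : F 0 4 5 = -F 0 2 3 := by linarith [htr 0, z12 0 1]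
  have t1 : F 1 4 5 = -F 1 2 3 := by linarith [htr 1, z12 1 0, h23 1 0 1]
  have t2 : F 2 4 5 = -F 0 1 2 := by linarith [htr 2, z12 2 3, h12 2 0 1, h23 0 2 1]
  have t3 : F 3 4 5 = -F 0 1 3 := by
    linarith [htr 3, z12 3 2, h23 3 2 3, h12 3 0 1, h23 0 3 1]
  have t4 : F 2 3 4 = -F 0 1 4 := by
    linarith [htr 4, z12 4 5, h12 4 0 1, h23 0 4 1, h12 4 2 3, h23 2 4 3]
  have t5 : F 2 3 5 = -F 0 1 5 := by
    linarith [htr 5, z12 5 4, h23 5 4 5, h12 5 0 1, h23 0 5 1, h12 5 2 3, h23 2 5 3]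
  have hG' : ∀ i j, G i j = -2 * (F i 0 1 * F j 0 1 + F i 2 3 * F j 2 3 + F i 4 5 * F j 4 5
      + F i 0 2 * F j 1 3 - F i 0 3 * F j 1 2 - F i 1 2 * F j 0 3 + F i 1 3 * F j 0 2
      + F i 0 4 * F j 1 5 - F i 0 5 * F j 1 4 - F i 1 4 * F j 0 5 + F i 1 5 * F j 0 4
      + F i 2 4 * F j 3 5 - F i 2 5 * F j 3 4 - F i 3 4 * F j 2 5 + F i 3 5 * F j 2 4) := by
    intro i j
    rw [hG]
    simp only [Fin.sum_univ_six]
    simp [conjIdx, conjSign, s23, z23]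
    ring
  have hsymm : ∀ i j, j < i → G i j = G j i := by
    intro i j _
    rw [hG', hG']
    ring
  have g00 := hG' 0 0
  have g01 := hG' 0 1
  have g02 := hG' 0 2
  have g03 := hG' 0 3
  have g04 := hG' 0 4
  have g05 := hG' 0 5
  have g11 := hG' 1 1
  have g12 := hG' 1 2
  have g13 := hG' 1 3
  have g14 := hG' 1 4
  have g15 := hG' 1 5
  have g22 := hG' 2 2
  have g23 := hG' 2 3
  have g24 := hG' 2 4
  have g25 := hG' 2 5
  have g33 := hG' 3 3
  have g34 := hG' 3 4
  have g35 := hG' 3 5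
  have g44 := hG' 4 4
  have g45 := hG' 4 5
  have g55 := hG' 5 5
  simp [s12, s23, z12, z23, t0, t1, t2, t3, t4, t5]
    at g00 g01 g02 g03 g04 g05 g11 g12 g13 g14 g15 g22 g23 g24 g25 g33 g34 g35 g44 g45 g55
  ring_nf
    at g00 g01 g02 g03 g04 g05 g11 g12 g13 g14 g15 g22 g23 g24 g25 g33 g34 g35 g44 g45 g55
  have key : ∀ a b c d : Fin 6, a < b → c < d →
      ∑ i, conjSign i * F i a b * F (conjIdx i) c d = (1 / 4 : ℝ) *
      (Ωmat a c * G b d - Ωmat b c * G a d - Ωmat a d * G b c + Ωmat b d * G a c) := by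
    intro a b c d hab hcd
    fin_cases a <;> fin_cases b <;> first | (exfalso; revert hab; decide) | skip
    all_goals fin_cases c <;> fin_cases d <;> first | (exfalso; revert hcd; decide) | skip
    all_goals
      simp [Ωmat_apply, Fin.sum_univ_six, conjIdx, conjSign, s12, s23, z12, z23,
        t0, t1, t2, t3, t4, t5, hsymm, hsymm 1 0 (by decide),
        g00, g01, g02, g03, g04, g05, g11, g12, g13, g14, g15, g22, g23, g24, g25, g33, g34,
          g35, g44, g45, g55]
    all_goals ring
  have key' : ∀ a b c d : Fin 6, a < b →
      ∑ i, conjSign i * F i a b * F (conjIdx i) c d = (1 / 4 : ℝ) *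
      (Ωmat a c * G b d - Ωmat b c * G a d - Ωmat a d * G b c + Ωmat b d * G a c) := by
    intro a b c d hab
    rcases lt_trichotomy c d with h | rfl | h
    · exact key a b c d hab h
    · simp [z23]
    · simp_rw [fun i => h23 (conjIdx i) c d, mul_neg, Finset.sum_neg_distrib,
        key a b d c hab h]
      ring
  rcases lt_trichotomy a b with h | rfl | h
  · exact key' a b c d h
  · simp [z23]
  · simp_rw [fun i => h23 i a b, mul_neg, neg_mul, Finset.sum_neg_distrib, key' b a c d h]
    ring

end TotallyAntisymmetric

/-- Quadratic contraction identity (pointwise form of Lemma contract1):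
`Σ_{i,j} ω^{ij} φ_{iab} φ_{jcd} = (1/4)(ω_{ac} g̃_{bd} − ω_{bc} g̃_{ad} − ω_{ad} g̃_{bc}
 + ω_{bd} g̃_{ac})`. -/
theorem quadratic_contraction_identity (φ : AlternatingMap ℝ V6 ℝ (Fin 3))
    (hprim : ∀ v : Fin 5 → V6, wedge23 ω6 (ap3 φ) v = 0)
    (hlam : lamH (ap3 φ) < 0)
    (hpos : ∀ x : V6, x ≠ 0 → 0 < ω6 x (Jmap (ap3 φ) x)) :
    ∀ a b c d : Fin 6,
      (∑ i : Fin 6, ∑ j : Fin 6, Ωmat⁻¹ i j * φ ![e6 i, e6 a, e6 b] * φ ![e6 j, e6 c, e6 d])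
        = (1 / 4 : ℝ) * (Ωmat a c * gTilde φ b d - Ωmat b c * gTilde φ a d
            - Ωmat a d * gTilde φ b c + Ωmat b d * gTilde φ a c) := by
  intro a b c d
  have h12 : ∀ i j k, φ ![e6 i, e6 j, e6 k] = -φ ![e6 j, e6 i, e6 k] := by
    intro i j k
    rw [← φ.map_swap _ (show (0 : Fin 3) ≠ 1 by decide)]
    congr 1
    ext x : 1
    fin_cases x <;> rfl
  have h23 : ∀ i j k, φ ![e6 i, e6 j, e6 k] = -φ ![e6 i, e6 k, e6 j] := by
    intro i j k
    rw [← φ.map_swap _ (show (1 : Fin 3) ≠ 2 by decide)]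
    congr 1
    ext x : 1
    fin_cases x <;> rfl
  have htr : TraceFree fun i j k => φ ![e6 i, e6 j, e6 k] := by
    refine traceFree_of_wedge h12 h23 fun w => ?_
    simpa [wedge23, ap3, Ωmat] using hprim fun k => e6 (w k)
  rw [← quadratic_contraction_of_traceFree h12 h23 htr (G := gTilde φ) ?_ a b c d]
  · simp [Ωmat_inv_apply, ite_mul]
  · intro i j
    simp only [gTilde, Ωmat_inv_apply, ite_mul, mul_ite, zero_mul, mul_zero,
      Finset.sum_ite_eq', Finset.mem_univ, if_true]
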